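/- Minimal complexes are unique in their homotopy class: if g : C → D is a homotopy equivalence of chain complexes with C minimal (meaning every self homotopy equivalence of C is an isomorphism), then there exists a chain map f : D → C with f ∘ g = id_C and g ∘ f homotopic to id_D. Consequently, any two homotopy-equivalent minimal complexes are isomorphic. -/

import Mathlib

open CategoryTheory

/-- Minimal complexes are unique in their homotopy class: if `C` is minimal (every
self homotopy equivalence of `C` is an isomorphism) and `g : C ⟶ D` is a homotopy
equivalence, then there is a chain map `f : D ⟶ C` with `f ∘ g = id_C` and `g ∘ f`
homotopic to `id_D`; consequently, if `D` is also minimal then `C ≅ D`. -/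
theorem minimal_complex_unique {ι : Type*} {V : Type*} [Category V] [Preadditive V]
    {c : ComplexShape ι} (C D : HomologicalComplex V c)
    (hC : ∀ e : HomotopyEquiv C C, IsIso e.hom)
    (g : C ⟶ D)
    (hg : ∃ f' : D ⟶ C,
      Nonempty (Homotopy (g ≫ f') (𝟙 C)) ∧ Nonempty (Homotopy (f' ≫ g) (𝟙 D))) :
    (∃ f : D ⟶ C, g ≫ f = 𝟙 C ∧ Nonempty (Homotopy (f ≫ g) (𝟙 D))) ∧
    ((∀ e : HomotopyEquiv D D, IsIso e.hom) → Nonempty (C ≅ D)) := by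
  obtain ⟨f', ⟨h₁⟩, ⟨h₂⟩⟩ := hg
  have hu : IsIso (g ≫ f') :=
    hC ⟨g ≫ f', 𝟙 C, (Homotopy.ofEq (Category.comp_id _)).trans h₁,
      (Homotopy.ofEq (Category.id_comp _)).trans h₁⟩
  have key : ∃ f : D ⟶ C, g ≫ f = 𝟙 C ∧ Nonempty (Homotopy (f ≫ g) (𝟙 D)) := by
    have k : Homotopy (inv (g ≫ f')) (𝟙 C) :=
      ((Homotopy.ofEq (Category.comp_id _).symm).trans
        (h₁.symm.compLeft (inv (g ≫ f')))).trans (Homotopy.ofEq (IsIso.inv_hom_id _))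
    refine ⟨f' ≫ inv (g ≫ f'), ?_, ⟨?_⟩⟩
    · rw [← Category.assoc, IsIso.hom_inv_id]
    · exact ((Homotopy.compLeftId k f').compRight g).trans h₂
  refine ⟨key, fun hD => ?_⟩
  obtain ⟨f, hf, ⟨h⟩⟩ := key
  have hv : IsIso (f ≫ g) :=
    hD ⟨f ≫ g, 𝟙 D, (Homotopy.ofEq (Category.comp_id _)).trans h,
      (Homotopy.ofEq (Category.id_comp _)).trans h⟩
  refine ⟨⟨g, f, hf, ?_⟩⟩
  rw [← cancel_epi (f ≫ g), Category.comp_id, Category.assoc, ← Category.assoc g f g, hf,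
    Category.id_comp]
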